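/- arXiv:2004.00780 — 2 statements merged into one kernel-verified Lean document; each statement's English description precedes it below -/
import Mathlib

section
/- For every nonzero q ∈ k, every central element of Λ_q is of the form λ·1 + z where λ ∈ k and z is a nilpotent central element; consequently the quotient of the center Z(Λ_q) by its nilradical is isomorphic to k. -/
noncomputable section

variable (k : Type) [Field k] (q : k)

/-- The generators `e₁, e₂, a, b, c` of the free algebra on five generators. -/
def gL (i : Fin 5) : FreeAlgebra k (Fin 5) := FreeAlgebra.ι k i

/-- The defining relations of the quiver algebra `Λ_q = kQ/I`:
`e₁² = e₁`, `e₂² = e₂`, `e₁e₂ = e₂e₁ = 0`, `e₁ + e₂ = 1`, `e₁ae₁ = a`, `e₁be₁ = b`,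
`e₁ce₂ = c`, `a² = 0`, `b² = 0`, `ab = q·ba`, `ac = 0`
(generators `0 ↦ e₁`, `1 ↦ e₂`, `2 ↦ a`, `3 ↦ b`, `4 ↦ c`). -/
inductive LRel (q : k) : FreeAlgebra k (Fin 5) → FreeAlgebra k (Fin 5) → Prop
  | e1e1 : LRel q (gL k 0 * gL k 0) (gL k 0)
  | e2e2 : LRel q (gL k 1 * gL k 1) (gL k 1)
  | e1e2 : LRel q (gL k 0 * gL k 1) 0
  | e2e1 : LRel q (gL k 1 * gL k 0) 0
  | esum : LRel q (gL k 0 + gL k 1) 1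
  | ea : LRel q (gL k 0 * gL k 2 * gL k 0) (gL k 2)
  | eb : LRel q (gL k 0 * gL k 3 * gL k 0) (gL k 3)
  | ec : LRel q (gL k 0 * gL k 4 * gL k 1) (gL k 4)
  | aa : LRel q (gL k 2 * gL k 2) 0
  | bb : LRel q (gL k 3 * gL k 3) 0
  | ab : LRel q (gL k 2 * gL k 3) (q • (gL k 3 * gL k 2))
  | ac : LRel q (gL k 2 * gL k 4) 0

/-- The quiver algebra `Λ_q = kQ/I` where `Q` has two vertices `1, 2`, loops `a, b`
at vertex `1` and an arrow `c : 1 → 2`, and `I = ⟨a², b², ab − qba, ac⟩`. -/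
def Lam := RingQuot (LRel k q)

instance : Ring (Lam k q) := inferInstanceAs (Ring (RingQuot (LRel k q)))
instance : Algebra k (Lam k q) := inferInstanceAs (Algebra k (RingQuot (LRel k q)))

/-- The image of `e₁` in `Λ_q`. -/
def e1L : Lam k q := (RingQuot.mkAlgHom k (LRel k q) (gL k 0) : RingQuot (LRel k q))
/-- The image of `e₂` in `Λ_q`. -/
def e2L : Lam k q := (RingQuot.mkAlgHom k (LRel k q) (gL k 1) : RingQuot (LRel k q))
/-- The image of `a` in `Λ_q`. -/
def aL : Lam k q := (RingQuot.mkAlgHom k (LRel k q) (gL k 2) : RingQuot (LRel k q))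
/-- The image of `b` in `Λ_q`. -/
def bL : Lam k q := (RingQuot.mkAlgHom k (LRel k q) (gL k 3) : RingQuot (LRel k q))
/-- The image of `c` in `Λ_q`. -/
def cL : Lam k q := (RingQuot.mkAlgHom k (LRel k q) (gL k 4) : RingQuot (LRel k q))


namespace Lam

/-- The quotient map from the free algebra onto `Λ_q`. -/
def mk : FreeAlgebra k (Fin 5) →ₐ[k] Lam k q := RingQuot.mkAlgHom k (LRel k q)

lemma mk_surjective : Function.Surjective (mk k q) :=
  RingQuot.mkAlgHom_surjective k (LRel k q)

variable {k q}

lemma mk_rel {x y : FreeAlgebra k (Fin 5)} (h : LRel k q x y) : mk k q x = mk k q y :=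
  RingQuot.mkAlgHom_rel k h

lemma e1_mul_e1 : e1L k q * e1L k q = e1L k q := by
  have h := mk_rel (LRel.e1e1 (k := k) (q := q))
  simp only [map_mul] at h
  exact h

lemma e2_mul_e2 : e2L k q * e2L k q = e2L k q := by
  have h := mk_rel (LRel.e2e2 (k := k) (q := q))
  simp only [map_mul] at h
  exact h

lemma e1_mul_e2 : e1L k q * e2L k q = 0 := by
  have h := mk_rel (LRel.e1e2 (k := k) (q := q))
  simp only [map_mul, map_zero] at h
  exact h

lemma e2_mul_e1 : e2L k q * e1L k q = 0 := by
  have h := mk_rel (LRel.e2e1 (k := k) (q := q))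
  simp only [map_mul, map_zero] at h
  exact h

lemma e1_add_e2 : e1L k q + e2L k q = 1 := by
  have h := mk_rel (LRel.esum (k := k) (q := q))
  simp only [map_add, map_one] at h
  exact h

lemma e1_mul_a_mul_e1 : e1L k q * aL k q * e1L k q = aL k q := by
  have h := mk_rel (LRel.ea (k := k) (q := q))
  simp only [map_mul] at h
  exact h

lemma e1_mul_b_mul_e1 : e1L k q * bL k q * e1L k q = bL k q := by
  have h := mk_rel (LRel.eb (k := k) (q := q))
  simp only [map_mul] at h
  exact h

lemma e1_mul_c_mul_e2 : e1L k q * cL k q * e2L k q = cL k q := by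
  have h := mk_rel (LRel.ec (k := k) (q := q))
  simp only [map_mul] at h
  exact h

lemma a_mul_a : aL k q * aL k q = 0 := by
  have h := mk_rel (LRel.aa (k := k) (q := q))
  simp only [map_mul, map_zero] at h
  exact h

lemma b_mul_b : bL k q * bL k q = 0 := by
  have h := mk_rel (LRel.bb (k := k) (q := q))
  simp only [map_mul, map_zero] at h
  exact h

lemma a_mul_b : aL k q * bL k q = q • (bL k q * aL k q) := by
  have h := mk_rel (LRel.ab (k := k) (q := q))
  simp only [map_mul, map_smul] at h
  exact h

lemma a_mul_c : aL k q * cL k q = 0 := by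
  have h := mk_rel (LRel.ac (k := k) (q := q))
  simp only [map_mul, map_zero] at h
  exact h

lemma e1_mul_a : e1L k q * aL k q = aL k q := by
  rw [← e1_mul_a_mul_e1, ← mul_assoc, ← mul_assoc, e1_mul_e1]

lemma e2_mul_a : e2L k q * aL k q = 0 := by
  rw [← e1_mul_a_mul_e1, ← mul_assoc, ← mul_assoc, e2_mul_e1, zero_mul, zero_mul]

lemma a_mul_e1 : aL k q * e1L k q = aL k q := by
  rw [← e1_mul_a_mul_e1, mul_assoc, e1_mul_e1]

lemma a_mul_e2 : aL k q * e2L k q = 0 := by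
  rw [← e1_mul_a_mul_e1, mul_assoc, e1_mul_e2, mul_zero]

lemma e1_mul_b : e1L k q * bL k q = bL k q := by
  rw [← e1_mul_b_mul_e1, ← mul_assoc, ← mul_assoc, e1_mul_e1]

lemma e2_mul_b : e2L k q * bL k q = 0 := by
  rw [← e1_mul_b_mul_e1, ← mul_assoc, ← mul_assoc, e2_mul_e1, zero_mul, zero_mul]

lemma b_mul_e1 : bL k q * e1L k q = bL k q := by
  rw [← e1_mul_b_mul_e1, mul_assoc, e1_mul_e1]

lemma b_mul_e2 : bL k q * e2L k q = 0 := by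
  rw [← e1_mul_b_mul_e1, mul_assoc, e1_mul_e2, mul_zero]

lemma e1_mul_c : e1L k q * cL k q = cL k q := by
  rw [← e1_mul_c_mul_e2, ← mul_assoc, ← mul_assoc, e1_mul_e1]

lemma e2_mul_c : e2L k q * cL k q = 0 := by
  rw [← e1_mul_c_mul_e2, ← mul_assoc, ← mul_assoc, e2_mul_e1, zero_mul, zero_mul]

lemma c_mul_e2 : cL k q * e2L k q = cL k q := by
  rw [← e1_mul_c_mul_e2, mul_assoc, e2_mul_e2]

lemma c_mul_e1 : cL k q * e1L k q = 0 := by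
  rw [← e1_mul_c_mul_e2, mul_assoc, e2_mul_e1, mul_zero]

lemma c_mul_a : cL k q * aL k q = 0 := by
  rw [← c_mul_e2, mul_assoc, e2_mul_a, mul_zero]

lemma c_mul_b : cL k q * bL k q = 0 := by
  rw [← c_mul_e2, mul_assoc, e2_mul_b, mul_zero]

lemma c_mul_c : cL k q * cL k q = 0 := by
  nth_rw 1 [← c_mul_e2]
  rw [mul_assoc, e2_mul_c, mul_zero]

variable (k q) in
/-- The element of `Λ_q` with the given coordinates in the basis `e₁, e₂, a, b, ba, c, bc`. -/
def ofCoords (x y α β γ δ ε : k) : Lam k q :=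
  x • e1L k q + y • e2L k q + α • aL k q + β • bL k q + γ • (bL k q * aL k q) +
    δ • cL k q + ε • (bL k q * cL k q)

lemma e1_mul_ofCoords (x y α β γ δ ε : k) :
    e1L k q * ofCoords k q x y α β γ δ ε = ofCoords k q x 0 α β γ δ ε := by
  simp [ofCoords, mul_add, ← mul_assoc, e1_mul_e1, e1_mul_e2, e1_mul_a, e1_mul_b, e1_mul_c]

lemma e2_mul_ofCoords (x y α β γ δ ε : k) :
    e2L k q * ofCoords k q x y α β γ δ ε = ofCoords k q 0 y 0 0 0 0 0 := by
  simp [ofCoords, mul_add, ← mul_assoc, e2_mul_e1, e2_mul_e2, e2_mul_a, e2_mul_b, e2_mul_c]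

lemma a_mul_ofCoords (x y α β γ δ ε : k) :
    aL k q * ofCoords k q x y α β γ δ ε = ofCoords k q 0 0 x 0 (β * q) 0 0 := by
  simp [ofCoords, mul_add, ← mul_assoc, a_mul_e1, a_mul_e2, a_mul_a, a_mul_b, a_mul_c]
  simp [mul_assoc, a_mul_a, a_mul_c, mul_smul]

lemma b_mul_ofCoords (x y α β γ δ ε : k) :
    bL k q * ofCoords k q x y α β γ δ ε = ofCoords k q 0 0 0 x α 0 δ := by
  simp [ofCoords, mul_add, ← mul_assoc, b_mul_e1, b_mul_e2, b_mul_b]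

lemma c_mul_ofCoords (x y α β γ δ ε : k) :
    cL k q * ofCoords k q x y α β γ δ ε = ofCoords k q 0 0 0 0 0 y 0 := by
  simp [ofCoords, mul_add, ← mul_assoc, c_mul_e1, c_mul_e2, c_mul_a, c_mul_b, c_mul_c]

lemma ofCoords_mul_e1 (x y α β γ δ ε : k) :
    ofCoords k q x y α β γ δ ε * e1L k q = ofCoords k q x 0 α β γ 0 0 := by
  simp [ofCoords, add_mul, mul_assoc, e1_mul_e1, e2_mul_e1, a_mul_e1, b_mul_e1, c_mul_e1]

lemma exists_mk_mul_eq_ofCoords (p : FreeAlgebra k (Fin 5)) :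
    ∀ x y α β γ δ ε : k, ∃ x' y' α' β' γ' δ' ε' : k,
      mk k q p * ofCoords k q x y α β γ δ ε =
        ofCoords k q x' y' α' β' γ' δ' ε' := by
  induction p using FreeAlgebra.induction with
  | grade0 r =>
    intro x y α β γ δ ε
    refine ⟨r * x, r * y, r * α, r * β, r * γ, r * δ, r * ε, ?_⟩
    rw [AlgHom.commutes, ← Algebra.smul_def]
    simp only [ofCoords, smul_add, smul_smul]
  | grade1 i =>
    intro x y α β γ δ ε
    fin_cases i
    · exact ⟨_, _, _, _, _, _, _, e1_mul_ofCoords x y α β γ δ ε⟩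
    · exact ⟨_, _, _, _, _, _, _, e2_mul_ofCoords x y α β γ δ ε⟩
    · exact ⟨_, _, _, _, _, _, _, a_mul_ofCoords x y α β γ δ ε⟩
    · exact ⟨_, _, _, _, _, _, _, b_mul_ofCoords x y α β γ δ ε⟩
    · exact ⟨_, _, _, _, _, _, _, c_mul_ofCoords x y α β γ δ ε⟩
  | mul p₁ p₂ h₁ h₂ =>
    intro x y α β γ δ ε
    obtain ⟨x', y', α', β', γ', δ', ε', h⟩ := h₂ x y α β γ δ ε
    rw [map_mul, mul_assoc, h]
    exact h₁ ..
  | add p₁ p₂ h₁ h₂ =>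
    intro x y α β γ δ ε
    obtain ⟨x₁, y₁, α₁, β₁, γ₁, δ₁, ε₁, h₁⟩ := h₁ x y α β γ δ ε
    obtain ⟨x₂, y₂, α₂, β₂, γ₂, δ₂, ε₂, h₂⟩ := h₂ x y α β γ δ ε
    refine ⟨x₁ + x₂, y₁ + y₂, α₁ + α₂, β₁ + β₂, γ₁ + γ₂, δ₁ + δ₂, ε₁ + ε₂, ?_⟩
    rw [map_add, add_mul, h₁, h₂]
    simp only [ofCoords, add_smul]
    abel

lemma exists_eq_ofCoords (z : Lam k q) :
    ∃ x y α β γ δ ε : k, z = ofCoords k q x y α β γ δ ε := by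
  obtain ⟨p, rfl⟩ := mk_surjective k q z
  obtain ⟨x, y, α, β, γ, δ, ε, h⟩ := exists_mk_mul_eq_ofCoords (q := q) p 1 1 0 0 0 0 0
  refine ⟨x, y, α, β, γ, δ, ε, ?_⟩
  rw [← h]
  simp [ofCoords, e1_add_e2]

lemma isNilpotent_ofCoords (α β γ : k) : IsNilpotent (ofCoords k q 0 0 α β γ 0 0) := by
  have a_ba : aL k q * (bL k q * aL k q) = 0 := by
    rw [← mul_assoc, a_mul_b, smul_mul_assoc, mul_assoc, a_mul_a, mul_zero, smul_zero]
  refine ⟨3, ?_⟩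
  simp [ofCoords, pow_succ, mul_add, add_mul, mul_assoc, a_mul_a, b_mul_b, a_mul_b, a_ba]
  simp [← mul_assoc, b_mul_b]

variable (k q) in
/-- The action of `Λ_q` on the two-dimensional module on which `a` and `b` act as zero. -/
def toMatrix : Lam k q →ₐ[k] Matrix (Fin 2) (Fin 2) k :=
  RingQuot.liftAlgHom k (s := LRel k q)
    ⟨FreeAlgebra.lift k ![!![1, 0; 0, 0], !![0, 0; 0, 1], 0, 0, !![0, 1; 0, 0]], by
      intro u v h
      cases h <;> simp [gL, ← Matrix.ext_iff, funext_iff, Fin.forall_fin_two]⟩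

lemma toMatrix_mk (p : FreeAlgebra k (Fin 5)) :
    toMatrix k q (mk k q p) =
      FreeAlgebra.lift k ![!![1, 0; 0, 0], !![0, 0; 0, 1], 0, 0, !![0, 1; 0, 0]] p :=
  RingQuot.liftAlgHom_mkAlgHom_apply ..

lemma toMatrix_c : toMatrix k q (cL k q) = !![0, 1; 0, 0] := by
  change toMatrix k q (mk k q (gL k 4)) = _
  simp [toMatrix_mk, gL]

lemma toMatrix_ofCoords (x y α β γ δ ε : k) :
    toMatrix k q (ofCoords k q x y α β γ δ ε) = !![x, δ; 0, y] := by
  have h1 : toMatrix k q (e1L k q) = !![1, 0; 0, 0] := by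
    change toMatrix k q (mk k q (gL k 0)) = _
    simp [toMatrix_mk, gL]
  have h2 : toMatrix k q (e2L k q) = !![0, 0; 0, 1] := by
    change toMatrix k q (mk k q (gL k 1)) = _
    simp [toMatrix_mk, gL]
  have ha : toMatrix k q (aL k q) = 0 := by
    change toMatrix k q (mk k q (gL k 2)) = _
    simp [toMatrix_mk, gL]
  have hb : toMatrix k q (bL k q) = 0 := by
    change toMatrix k q (mk k q (gL k 3)) = _
    simp [toMatrix_mk, gL]
  simp [ofCoords, h1, h2, ha, hb, toMatrix_c]

instance : Nontrivial (Lam k q) := (toMatrix k q).toRingHom.domain_nontrivial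

lemma exists_eq_algebraMap_add_of_mem_center {z : Lam k q}
    (hz : z ∈ Subalgebra.center k (Lam k q)) :
    ∃ (c : k) (w : Lam k q), w ∈ Subalgebra.center k (Lam k q) ∧ IsNilpotent w ∧
      z = algebraMap k (Lam k q) c + w := by
  obtain ⟨x, y, α, β, γ, δ, ε, h⟩ := exists_eq_ofCoords z
  have comm := Subalgebra.mem_center_iff.mp hz
  have hxy : x = y := by
    have := congrArg (fun w => toMatrix k q w 0 1) (comm (cL k q))
    simpa [h, toMatrix_c, toMatrix_ofCoords, eq_comm] using this
  have hz' : z = algebraMap k (Lam k q) x + ofCoords k q 0 0 α β γ 0 0 := by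
    have he := comm (e1L k q)
    rw [h, e1_mul_ofCoords, ofCoords_mul_e1] at he
    have hc : δ • cL k q + ε • (bL k q * cL k q) = 0 := by
      simpa [ofCoords, add_assoc] using he
    rw [h, ← hxy, Algebra.algebraMap_eq_smul_one, ← e1_add_e2, smul_add]
    simp only [ofCoords, zero_smul, zero_add, add_zero]
    rw [add_assoc _ (δ • _), hc]
    abel
  refine ⟨x, _, ?_, isNilpotent_ofCoords α β γ, hz'⟩
  rw [← sub_eq_iff_eq_add'.mpr hz']
  exact sub_mem hz (Subalgebra.algebraMap_mem _ x)

end Lam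

/-- STATEMENT 4: for every nonzero `q`, every central element of `Λ_q` is
`λ·1 + z` with `λ ∈ k` and `z` a nilpotent central element; consequently the
quotient of the center `Z(Λ_q)` by its nilradical is isomorphic to `k`. -/
theorem stmt4 (hq : q ≠ 0) :
    (∀ z ∈ Subalgebra.center k (Lam k q), ∃ (c : k) (w : Lam k q),
      w ∈ Subalgebra.center k (Lam k q) ∧ IsNilpotent w ∧
      z = algebraMap k (Lam k q) c + w) ∧
    Nonempty ((↥(Subalgebra.center k (Lam k q)) ⧸
      nilradical ↥(Subalgebra.center k (Lam k q))) ≃ₐ[k] k) := by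
  have decomp := fun z => Lam.exists_eq_algebraMap_add_of_mem_center (k := k) (q := q) (z := z)
  refine ⟨decomp, ⟨(AlgEquiv.ofBijective (Algebra.ofId k _) ⟨?_, ?_⟩).symm⟩⟩
  · have : Nontrivial (↥(Subalgebra.center k (Lam k q)) ⧸
        nilradical ↥(Subalgebra.center k (Lam k q))) := by
      refine Ideal.Quotient.nontrivial_iff.mpr ((Ideal.ne_top_iff_one _).mpr fun h => ?_)
      exact not_isNilpotent_one (mem_nilradical.mp h)
    exact (algebraMap k _).injective
  · intro u
    obtain ⟨⟨z, hz⟩, rfl⟩ := Ideal.Quotient.mk_surjective u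
    obtain ⟨c, w, hw, ⟨n, hn⟩, h⟩ := decomp z hz
    refine ⟨c, (Ideal.Quotient.eq.mpr ?_).symm⟩
    rw [mem_nilradical]
    refine ⟨n, Subtype.ext ?_⟩
    change (z - algebraMap k (Lam k q) c) ^ n = 0
    rw [h, add_sub_cancel_left, hn]

end
end

section
/- The product of any two elements of T lies in the k-span of the monomials x^{2i}y^{2j} with j ≥ 2; in particular, for every n ≥ 1 the monomial x^{2(n−1)}y² does not lie in T·T, so x^{2(n−1)}y² cannot be written as a product of elements of T of lower degree and every algebra generating set of T must contain, for each n ≥ 1, an element with a nonzero x^{2(n−1)}y² coefficient. -/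
noncomputable section

variable (k : Type) [Field k]

/-- The set of monomials `x^{2i} y^{2j}` with `i ≥ 0`, `j ≥ 1`, inside `k[x,y]`
(with `x = X 0` and `y = X 1`). -/
def Tmon : Set (MvPolynomial (Fin 2) k) :=
  {p | ∃ i j : ℕ, 1 ≤ j ∧ p = MvPolynomial.X 0 ^ (2 * i) * MvPolynomial.X 1 ^ (2 * j)}

/-- `T = k[x²,y²]y²`, the `k`-linear span of the monomials `x^{2i}y^{2j}`, `j ≥ 1`. -/
def Tsub : Submodule k (MvPolynomial (Fin 2) k) := Submodule.span k (Tmon k)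

/-- The `k`-linear span of the monomials `x^{2i}y^{2j}` with `j ≥ 2`. -/
def Tsub₂ : Submodule k (MvPolynomial (Fin 2) k) :=
  Submodule.span k
    {z : MvPolynomial (Fin 2) k | ∃ i j : ℕ, 2 ≤ j ∧
      z = MvPolynomial.X 0 ^ (2 * i) * MvPolynomial.X 1 ^ (2 * j)}

variable {k}

theorem mul_mem_Tsub₂ {p p' : MvPolynomial (Fin 2) k} (hp : p ∈ Tsub k) (hp' : p' ∈ Tsub k) :
    p * p' ∈ Tsub₂ k := by
  have h := Submodule.mul_mem_mul hp hp'
  rw [Tsub, Submodule.span_mul_span] at h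
  refine Submodule.span_mono ?_ h
  rintro _ ⟨_, ⟨i, j, hj, rfl⟩, _, ⟨i', j', hj', rfl⟩, rfl⟩
  exact ⟨i + i', j + j', by omega, by ring⟩

theorem Tsub₂_le_Tsub : Tsub₂ k ≤ Tsub k := by
  refine Submodule.span_mono ?_
  rintro _ ⟨i, j, hj, rfl⟩
  exact ⟨i, j, by omega, rfl⟩

theorem X_pow_mul_X_pow_eq_monomial (a b : ℕ) :
    (MvPolynomial.X 0 ^ a * MvPolynomial.X 1 ^ b : MvPolynomial (Fin 2) k) =
      MvPolynomial.monomial (Finsupp.single 0 a + Finsupp.single 1 b) 1 := by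
  simp [MvPolynomial.X_pow_eq_monomial, MvPolynomial.monomial_mul]

theorem coeff_eq_zero_of_mem_Tsub₂ {p : MvPolynomial (Fin 2) k} (hp : p ∈ Tsub₂ k) (a : ℕ) :
    MvPolynomial.coeff (Finsupp.single 0 a + Finsupp.single 1 2) p = 0 := by
  induction hp using Submodule.span_induction with
  | mem x hx =>
    obtain ⟨i, j, hj, rfl⟩ := hx
    rw [X_pow_mul_X_pow_eq_monomial, MvPolynomial.coeff_monomial, if_neg]
    intro h
    have h₁ := DFunLike.congr_fun h 1
    simp at h₁
    omega
  | zero => simp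
  | add x y _ _ hx hy => simp [hx, hy]
  | smul c x _ hx => simp [hx]

theorem X_pow_mul_X_sq_notMem_Tsub₂ (a : ℕ) :
    (MvPolynomial.X 0 ^ a * MvPolynomial.X 1 ^ 2 : MvPolynomial (Fin 2) k) ∉ Tsub₂ k := by
  intro h
  have h₀ := coeff_eq_zero_of_mem_Tsub₂ h a
  rw [X_pow_mul_X_pow_eq_monomial, MvPolynomial.coeff_monomial, if_pos rfl] at h₀
  exact one_ne_zero h₀

theorem mem_Tsub_and_coeff_eq_zero_of_mem_adjoin {G : Set (MvPolynomial (Fin 2) k)}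
    (hG : G ⊆ (Tsub k : Set (MvPolynomial (Fin 2) k))) (a : ℕ)
    (hG₀ : ∀ g ∈ G, MvPolynomial.coeff (Finsupp.single 0 a + Finsupp.single 1 2) g = 0)
    {p : MvPolynomial (Fin 2) k} (hp : p ∈ NonUnitalAlgebra.adjoin k G) :
    p ∈ Tsub k ∧ MvPolynomial.coeff (Finsupp.single 0 a + Finsupp.single 1 2) p = 0 := by
  induction hp using NonUnitalAlgebra.adjoin_induction with
  | mem x hx => exact ⟨hG hx, hG₀ x hx⟩
  | add x y _ _ hx hy => exact ⟨add_mem hx.1 hy.1, by simp [hx.2, hy.2]⟩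
  | zero => exact ⟨zero_mem _, by simp⟩
  | mul x y _ _ hx hy =>
    have h := mul_mem_Tsub₂ hx.1 hy.1
    exact ⟨Tsub₂_le_Tsub h, coeff_eq_zero_of_mem_Tsub₂ h a⟩
  | smul c x _ hx => exact ⟨Submodule.smul_mem _ c hx.1, by simp [hx.2]⟩

variable (k)

/-- STATEMENT 19: the product of any two elements of `T` lies in the span of the
monomials `x^{2i}y^{2j}` with `j ≥ 2`; in particular for every `n ≥ 1` the monomial
`x^{2(n−1)}y²` does not lie in `T·T`, so it cannot be written as a product of
elements of `T`, and every algebra generating set of `T` must contain, for each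
`n ≥ 1`, an element with a nonzero `x^{2(n−1)}y²` coefficient. -/
theorem stmt19 :
    (∀ p ∈ Tsub k, ∀ p' ∈ Tsub k, p * p' ∈
      Submodule.span k
        {z : MvPolynomial (Fin 2) k | ∃ i j : ℕ, 2 ≤ j ∧
          z = MvPolynomial.X 0 ^ (2 * i) * MvPolynomial.X 1 ^ (2 * j)}) ∧
    (∀ n : ℕ, 1 ≤ n →
      (MvPolynomial.X 0 ^ (2 * (n - 1)) * MvPolynomial.X 1 ^ 2 : MvPolynomial (Fin 2) k) ∉
        Submodule.span k
          {z : MvPolynomial (Fin 2) k | ∃ t ∈ Tsub k, ∃ t' ∈ Tsub k, z = t * t'}) ∧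
    (∀ G : Set (MvPolynomial (Fin 2) k), G ⊆ (Tsub k : Set (MvPolynomial (Fin 2) k)) →
      (∀ p ∈ Tsub k, p ∈ NonUnitalAlgebra.adjoin k G) →
      ∀ n : ℕ, 1 ≤ n → ∃ g ∈ G,
        MvPolynomial.coeff (Finsupp.single 0 (2 * (n - 1)) + Finsupp.single 1 2) g ≠ 0) := by
  refine ⟨fun p hp p' hp' => mul_mem_Tsub₂ hp hp', fun n _ h => ?_, fun G hG hgen n _ => ?_⟩
  · refine X_pow_mul_X_sq_notMem_Tsub₂ _ (Submodule.span_le.2 ?_ h)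
    rintro _ ⟨t, ht, t', ht', rfl⟩
    exact mul_mem_Tsub₂ ht ht'
  · by_contra! hG₀
    have hmem : (MvPolynomial.X 0 ^ (2 * (n - 1)) * MvPolynomial.X 1 ^ 2 :
        MvPolynomial (Fin 2) k) ∈ Tsub k :=
      Submodule.subset_span ⟨n - 1, 1, le_rfl, rfl⟩
    have h := (mem_Tsub_and_coeff_eq_zero_of_mem_adjoin hG _ hG₀ (hgen _ hmem)).2
    rw [X_pow_mul_X_pow_eq_monomial, MvPolynomial.coeff_monomial, if_pos rfl] at h
    exact one_ne_zero h

end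
end
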